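/- arXiv:2505.04674 — 5 statements merged into one kernel-verified Lean document; each statement's English description precedes it below -/
import Mathlib

section
/- Let G be a finite simple graph, CS an independent set of G, v a vertex of G, and r ≥ 1 an integer. Let D = {u ∈ V(G) : d_G(v,u) ≤ r} \ {u : d_G(v,u) = r and u is adjacent to some w ∈ CS with d_G(v,w) = r+1}. Then for every set S ⊆ D that is an independent set of the induced subgraph G[D], the set (CS \ D) ∪ S is an independent set of G. -/
/-- `I` is an independent set of the simple graph `G`: no two of its vertices are adjacent. -/
def IsIndep {V : Type*} (G : SimpleGraph V) (I : Set V) : Prop :=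
  ∀ u ∈ I, ∀ w ∈ I, ¬ G.Adj u w

/-- A vertex of `CS` outside the local graph is adjacent to no vertex of the local graph. -/
theorem IsIndep.not_adj_local_graph {V : Type*} {G : SimpleGraph V} {CS : Set V}
    (hCS : IsIndep G CS) {v : V} {r : ℕ} {D : Set V}
    (hD : D = {u | G.Reachable v u ∧ G.dist v u ≤ r} \
          {u | G.dist v u = r ∧ ∃ w ∈ CS, G.Adj u w ∧ G.dist v w = r + 1})
    {x s : V} (hx : x ∈ CS \ D) (hs : s ∈ D) : ¬ G.Adj s x := by
  subst hD
  intro hadj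
  obtain ⟨hxCS, hxD⟩ := hx
  obtain ⟨⟨hreach, hle⟩, hbd⟩ := hs
  have hdist : G.dist v x ≤ G.dist v s + 1 := by
    simpa [SimpleGraph.dist_eq_one_iff_adj.2 hadj] using hreach.dist_triangle_left x
  have hgt : r < G.dist v x := by
    by_contra! hxr
    refine hxD ⟨⟨hreach.trans hadj.reachable, hxr⟩, ?_⟩
    rintro ⟨-, w, hw, hxw, -⟩
    exact hCS x hxCS w hw hxw
  exact hbd ⟨by omega, x, hxCS, hadj, by omega⟩

/-- Correctness of the region location mechanism of DynLS: if `D` is the vertex set of the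
`(v, r, CS)`-local graph, then any independent set `S` of the induced subgraph `G[D]`
can be spliced into `CS`, i.e. `(CS \ D) ∪ S` is an independent set of `G`. -/
theorem local_graph_splice_indep {V : Type*} [Fintype V] (G : SimpleGraph V)
    (CS : Set V) (hCS : IsIndep G CS) (v : V) (r : ℕ) (hr : 1 ≤ r)
    (D : Set V)
    (hD : D = {u | G.Reachable v u ∧ G.dist v u ≤ r} \
          {u | G.dist v u = r ∧ ∃ w ∈ CS, G.Adj u w ∧ G.dist v w = r + 1})
    (S : Set V) (hSD : S ⊆ D) (hS : IsIndep G S) :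
    IsIndep G ((CS \ D) ∪ S) := by
  rintro x (hx | hx) y (hy | hy) hadj
  · exact hCS x hx.1 y hy.1 hadj
  · exact hCS.not_adj_local_graph hD hx (hSD hy) hadj.symm
  · exact hCS.not_adj_local_graph hD hy (hSD hx) hadj
  · exact hS x hx y hy hadj
end

section
/- Let G be a finite simple graph, CS an independent set of G, v a vertex of G, and r ≥ 1 an integer. Let D = {u ∈ V(G) : d_G(v,u) ≤ r} \ {u : d_G(v,u) = r and u is adjacent to some w ∈ CS with d_G(v,w) = r+1}. Then no vertex u ∈ D is adjacent to any vertex w ∈ CS that does not lie within distance r of v (i.e., w is either unreachable from v or satisfies d_G(v,w) > r). -/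
/-- Boundary lemma for the `(v, r, CS)`-local graph of DynLS: no vertex `u ∈ D` is adjacent
to a vertex `w ∈ CS` that does not lie within distance `r` of `v` (i.e. `w` is either
unreachable from `v` or satisfies `d_G(v,w) > r`). -/
theorem local_graph_boundary {V : Type*} [Fintype V] (G : SimpleGraph V)
    (CS : Set V) (hCS : IsIndep G CS) (v : V) (r : ℕ) (hr : 1 ≤ r)
    (D : Set V)
    (hD : D = {u | G.Reachable v u ∧ G.dist v u ≤ r} \
          {u | G.dist v u = r ∧ ∃ w ∈ CS, G.Adj u w ∧ G.dist v w = r + 1}) :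
    ∀ u ∈ D, ∀ w ∈ CS, (¬ G.Reachable v w ∨ r < G.dist v w) → ¬ G.Adj u w := by
  subst hD
  rintro u ⟨⟨hvu, hur⟩, hu⟩ w hw hfar huw
  have hvw : G.Reachable v w := hvu.trans huw.reachable
  have hlt : r < G.dist v w := hfar.resolve_left (not_not_intro hvw)
  have hle : G.dist v w ≤ G.dist v u + 1 := by
    obtain ⟨p, hp⟩ := hvu.exists_walk_length_eq_dist
    simpa [hp] using SimpleGraph.dist_le (p.concat huw)
  exact hu ⟨by omega, w, hw, huw, by omega⟩
end

section
/- Let G be a finite simple graph with a positive vertex-weight function σ, I an independent set of G, v ∈ I, and u₁, u₂ two distinct non-adjacent vertices outside I such that N(u₁) ∩ I = {v} and N(u₂) ∩ I = {v}. Then (I \ {v}) ∪ {u₁, u₂} is an independent set of G whose weight equals σ(I) − σ(v) + σ(u₁) + σ(u₂); in particular, if σ(u₁) + σ(u₂) > σ(v), the new independent set has strictly larger weight than I. -/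
open scoped BigOperators

/-- Exchanging `v ∈ I` for vertices `u₁, u₂ ∉ I` changes the weight by `σ u₁ + σ u₂ - σ v`. -/
theorem finsum_mem_swap {V M : Type*} [Finite V] [AddCommGroup M] (σ : V → M) {I : Set V}
    {v u₁ u₂ : V} (hv : v ∈ I) (hne : u₁ ≠ u₂) (hu₁ : u₁ ∉ I) (hu₂ : u₂ ∉ I) :
    (∑ᶠ u ∈ (I \ {v}) ∪ {u₁, u₂}, σ u) = (∑ᶠ u ∈ I, σ u) - σ v + σ u₁ + σ u₂ := by
  have hdisj : Disjoint (I \ {v}) {u₁, u₂} := by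
    rw [Set.disjoint_left]
    rintro x ⟨hx, -⟩ (rfl | rfl)
    exacts [hu₁ hx, hu₂ hx]
  have hremove : (∑ᶠ u ∈ I, σ u) = σ v + ∑ᶠ u ∈ I \ {v}, σ u := by
    rw [← finsum_mem_insert σ (by simp) (Set.toFinite (I \ {v})),
      Set.insert_sdiff_singleton, Set.insert_eq_of_mem hv]
  rw [finsum_mem_union hdisj (Set.toFinite _) (Set.toFinite _), finsum_mem_pair hne, hremove]
  abel

/-- If `v` is the only neighbor in `I` of each of the non-adjacent vertices `u₁` and `u₂`,
then replacing `v` by `u₁, u₂` preserves independence. -/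
theorem IsIndep.swap {V : Type*} {G : SimpleGraph V} {I : Set V} (hI : IsIndep G I)
    {v u₁ u₂ : V} (hnadj : ¬ G.Adj u₁ u₂) (hN₁ : G.neighborSet u₁ ∩ I = {v})
    (hN₂ : G.neighborSet u₂ ∩ I = {v}) : IsIndep G ((I \ {v}) ∪ {u₁, u₂}) := by
  have h₁ : ∀ x ∈ I, G.Adj u₁ x → x = v := fun x hx h => hN₁.subset ⟨h, hx⟩
  have h₂ : ∀ x ∈ I, G.Adj u₂ x → x = v := fun x hx h => hN₂.subset ⟨h, hx⟩
  rintro a (⟨ha, hav⟩ | rfl | rfl) b (⟨hb, hbv⟩ | rfl | rfl) hab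
  exacts [hI a ha b hb hab, hav (h₁ a ha hab.symm), hav (h₂ a ha hab.symm),
    hbv (h₁ b hb hab), G.irrefl hab, hnadj hab,
    hbv (h₂ b hb hab), hnadj hab.symm, G.irrefl hab]

/-- Correctness of the weighted `(1,2)`-swap (2-improvement) of DynLS: if `v ∈ I` and
`u₁, u₂` are distinct non-adjacent vertices outside `I` with `N(u₁) ∩ I = {v}` and
`N(u₂) ∩ I = {v}`, then `(I \ {v}) ∪ {u₁, u₂}` is an independent set of weight
`σ(I) − σ(v) + σ(u₁) + σ(u₂)`; in particular if `σ(u₁) + σ(u₂) > σ(v)` then it has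
strictly larger weight than `I`. -/
theorem two_improvement {V : Type*} [Fintype V] (G : SimpleGraph V)
    (σ : V → ℝ) (hσ : ∀ u, 0 < σ u)
    (I : Set V) (hI : IsIndep G I) (v u₁ u₂ : V) (hv : v ∈ I)
    (hne : u₁ ≠ u₂) (hnadj : ¬ G.Adj u₁ u₂) (hu₁ : u₁ ∉ I) (hu₂ : u₂ ∉ I)
    (hN₁ : G.neighborSet u₁ ∩ I = {v}) (hN₂ : G.neighborSet u₂ ∩ I = {v}) :
    IsIndep G ((I \ {v}) ∪ {u₁, u₂}) ∧
    (∑ᶠ u ∈ (I \ {v}) ∪ {u₁, u₂}, σ u)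
      = (∑ᶠ u ∈ I, σ u) - σ v + σ u₁ + σ u₂ ∧
    (σ v < σ u₁ + σ u₂ →
      (∑ᶠ u ∈ I, σ u) < (∑ᶠ u ∈ (I \ {v}) ∪ {u₁, u₂}, σ u)) := by
  have hweight := finsum_mem_swap σ hv hne hu₁ hu₂
  refine ⟨hI.swap hnadj hN₁ hN₂, hweight, fun h => ?_⟩
  rw [hweight]
  linarith
end

section
/- Let G be a finite simple graph with a positive vertex-weight function σ, CS an independent set of G, v ∈ CS, and S a nonempty independent subset of N(v) such that every u ∈ S has tightness τ(u) = 1 (i.e., N(u) ∩ CS = {v}). Then N(S) ∩ CS = {v}, the set (CS \ {v}) ∪ S is an independent set of G, and σ((CS \ {v}) ∪ S) = σ(CS) − σ(v) + σ(S). -/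
open scoped BigOperators

/-- The neighborhood of a set `S`: vertices outside `S` adjacent to some vertex of `S`. -/
def setNbhd {V : Type*} (G : SimpleGraph V) (S : Set V) : Set V :=
  {u | u ∉ S ∧ ∃ w ∈ S, G.Adj u w}

/-- Correctness of the `(v; x, 0)`-exchange of DynLS: if `v ∈ CS` and `S` is a nonempty
independent subset of `N(v)` all of whose vertices have tightness one
(`N(u) ∩ CS = {v}`), then `N(S) ∩ CS = {v}`, the set `(CS \ {v}) ∪ S` is an
independent set of `G`, and its weight equals `σ(CS) − σ(v) + σ(S)`. -/
theorem x_zero_exchange {V : Type*} [Fintype V] (G : SimpleGraph V)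
    (σ : V → ℝ) (hσ : ∀ u, 0 < σ u)
    (CS : Set V) (hCS : IsIndep G CS) (v : V) (hv : v ∈ CS)
    (S : Set V) (hSne : S.Nonempty) (hSsub : S ⊆ G.neighborSet v)
    (hSind : IsIndep G S) (htight : ∀ u ∈ S, G.neighborSet u ∩ CS = {v}) :
    setNbhd G S ∩ CS = {v} ∧
    IsIndep G ((CS \ {v}) ∪ S) ∧
    (∑ᶠ u ∈ (CS \ {v}) ∪ S, σ u) = (∑ᶠ u ∈ CS, σ u) - σ v + (∑ᶠ u ∈ S, σ u) := by
  have key : ∀ u ∈ S, ∀ w ∈ CS, G.Adj u w → w = v := fun u hu w hw h => by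
    have hmem : w ∈ G.neighborSet u ∩ CS := ⟨h, hw⟩
    rwa [htight u hu] at hmem
  have hdisj : ∀ u ∈ S, u ∉ CS := fun u hu huC => hCS v hv u huC (hSsub hu)
  refine ⟨?_, ?_, ?_⟩
  · ext w
    constructor
    · rintro ⟨⟨-, u, hu, hwu⟩, hw⟩
      exact key u hu w hw hwu.symm
    · rintro rfl
      obtain ⟨u, hu⟩ := hSne
      exact ⟨⟨fun hw => hdisj w hw hv, u, hu, hSsub hu⟩, hv⟩
  · rintro u (⟨hu, huv⟩ | hu) w (⟨hw, hwv⟩ | hw) h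
    · exact hCS u hu w hw h
    · exact huv (key w hw u hu h.symm)
    · exact hwv (key u hu w hw h)
    · exact hSind u hu w hw h
  · have hd : Disjoint (CS \ {v}) S :=
      Set.disjoint_left.2 fun u hu huS => hdisj u huS hu.1
    have hsum : (∑ᶠ u ∈ CS, σ u) = σ v + ∑ᶠ u ∈ CS \ {v}, σ u := by
      rw [← finsum_mem_insert σ (fun h => h.2 rfl) (Set.toFinite _),
        Set.insert_sdiff_singleton, Set.insert_eq_of_mem hv]
    rw [finsum_mem_union hd (Set.toFinite _) (Set.toFinite _), hsum]
    ring
end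

section
/- Let G be a finite simple graph, CS an independent set of G, v ∈ CS, and S an independent subset of N(v) such that every u ∈ S has tightness τ(u) ∈ {1, 2}, and exactly y vertices of S have tightness 2. Then v ∈ N(S) ∩ CS and |N(S) ∩ CS| ≤ y + 1; that is, performing the (v;x,y)-exchange removes at most y + 1 vertices from CS. -/
/-- The `(v; x, y)`-exchange of DynLS removes at most `y + 1` vertices from `CS`:
if `v ∈ CS` and `S` is a nonempty independent subset of `N(v)` all of whose vertices
have tightness `1` or `2`, with exactly `y` vertices of tightness `2`, then
`v ∈ N(S) ∩ CS` and `|N(S) ∩ CS| ≤ y + 1`. -/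
theorem xy_exchange_removal_bound {V : Type*} [Fintype V] (G : SimpleGraph V)
    (CS : Set V) (hCS : IsIndep G CS) (v : V) (hv : v ∈ CS)
    (S : Set V) (hSne : S.Nonempty) (hSsub : S ⊆ G.neighborSet v)
    (hSind : IsIndep G S) (y : ℕ)
    (htight : ∀ u ∈ S, (G.neighborSet u ∩ CS).ncard = 1 ∨ (G.neighborSet u ∩ CS).ncard = 2)
    (hy : {u ∈ S | (G.neighborSet u ∩ CS).ncard = 2}.ncard = y) :
    v ∈ setNbhd G S ∩ CS ∧ (setNbhd G S ∩ CS).ncard ≤ y + 1 := by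
  have hvN : ∀ u ∈ S, v ∈ G.neighborSet u ∩ CS := fun u hu => ⟨(hSsub hu).symm, hv⟩
  refine ⟨⟨⟨fun hvS => G.irrefl (hSsub hvS), ?_⟩, hv⟩, ?_⟩
  · obtain ⟨u, hu⟩ := hSne
    exact ⟨u, hu, hSsub hu⟩
  have hpartner : ∀ u, ∃ w, u ∈ S → (G.neighborSet u ∩ CS).ncard = 2 →
      G.neighborSet u ∩ CS ⊆ {v, w} := by
    intro u
    by_cases h : u ∈ S ∧ (G.neighborSet u ∩ CS).ncard = 2
    · obtain ⟨a, b, -, hab⟩ := Set.ncard_eq_two.mp h.2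
      have hva : v = a ∨ v = b := by simpa [hab] using hvN u h.1
      rcases hva with rfl | rfl
      · exact ⟨b, fun _ _ => hab.subset⟩
      · exact ⟨a, fun _ _ => by rw [hab, Set.pair_comm]⟩
    · exact ⟨v, fun h₁ h₂ => absurd ⟨h₁, h₂⟩ h⟩
  choose f hf using hpartner
  have hcover : setNbhd G S ∩ CS ⊆
      insert v (f '' {u ∈ S | (G.neighborSet u ∩ CS).ncard = 2}) := by
    rintro w ⟨⟨-, u, hu, hwu⟩, hw⟩
    have hwN : w ∈ G.neighborSet u ∩ CS := ⟨hwu.symm, hw⟩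
    rcases htight u hu with h | h
    · obtain ⟨a, ha⟩ := Set.ncard_eq_one.mp h
      have hva : v = a := by simpa [ha] using hvN u hu
      have hwa : w = a := by simpa [ha] using hwN
      exact Or.inl (hwa.trans hva.symm)
    · rcases hf u hu h hwN with hwv | hwf
      · exact Or.inl hwv
      · exact Or.inr ⟨u, ⟨hu, h⟩, hwf.symm⟩
  calc (setNbhd G S ∩ CS).ncard
      ≤ (insert v (f '' {u ∈ S | (G.neighborSet u ∩ CS).ncard = 2})).ncard :=
        Set.ncard_le_ncard hcover (Set.toFinite _)
    _ ≤ (f '' {u ∈ S | (G.neighborSet u ∩ CS).ncard = 2}).ncard + 1 := Set.ncard_insert_le _ _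
    _ ≤ y + 1 := by
        rw [← hy]
        exact Nat.add_le_add_right (Set.ncard_image_le (Set.toFinite _)) 1
end
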